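/- Let R, S: ℝ² → ℝ be C¹, let t: ℝ² → ℝ be C³ satisfying (S − R) t_{rs} = R_r t_s − S_s t_r everywhere, and let x: ℝ² → ℝ be C² satisfying x_r = −S t_r and x_s = −R t_s everywhere. Define the vector field X f = −t_{rs} f_r + t_{rr} f_s acting on C¹ functions. Then at every point p where t_r(p) = 0, t_{rr}(p) = 0, and R(p) ≠ S(p), one has (X(X t))(p) = R_r(p) t_s(p)² t_{rrr}(p) / (R(p) − S(p)) and (X(X x))(p) = −R(p) · R_r(p) t_s(p)² t_{rrr}(p) / (R(p) − S(p)). In particular, if moreover t_s(p) ≠ 0, t_{rrr}(p) ≠ 0, and R_r(p) ≠ 0, then (X t, X x)(p) = (0,0) while (X(X t), X(X x))(p) ≠ (0,0) (Whitney cusp condition). -/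

import Mathlib

/-- Partial derivative in the first variable `r`. -/
noncomputable def pr (f : ℝ × ℝ → ℝ) (p : ℝ × ℝ) : ℝ := fderiv ℝ f p (1, 0)

/-- Partial derivative in the second variable `s`. -/
noncomputable def ps (f : ℝ × ℝ → ℝ) (p : ℝ × ℝ) : ℝ := fderiv ℝ f p (0, 1)

/-- The Whitney-type vector field `X f = −t_{rs} f_r + t_{rr} f_s`, viewed as an
operator taking a function `f` to the function `X f`. -/
noncomputable def Xop (t f : ℝ × ℝ → ℝ) : ℝ × ℝ → ℝ := fun p =>
  -(ps (pr t) p) * pr f p + (pr (pr t) p) * ps f p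

theorem ContDiff.pr {f : ℝ × ℝ → ℝ} {m n : WithTop ℕ∞} (hf : ContDiff ℝ n f) (hmn : m + 1 ≤ n) :
    ContDiff ℝ m (pr f) :=
  (hf.fderiv_right hmn).clm_apply contDiff_const

theorem ContDiff.ps {f : ℝ × ℝ → ℝ} {m n : WithTop ℕ∞} (hf : ContDiff ℝ n f) (hmn : m + 1 ≤ n) :
    ContDiff ℝ m (ps f) :=
  (hf.fderiv_right hmn).clm_apply contDiff_const

/-- If `u`, `u_r` and `b` vanish at `p`, then `a u + b v` has `r`-derivative `b_r v` at `p`. -/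
theorem pr_mul_add_mul_of_eq_zero {a u b v : ℝ × ℝ → ℝ} {p : ℝ × ℝ}
    (ha : DifferentiableAt ℝ a p) (hu : DifferentiableAt ℝ u p)
    (hb : DifferentiableAt ℝ b p) (hv : DifferentiableAt ℝ v p)
    (hu0 : u p = 0) (hur : pr u p = 0) (hb0 : b p = 0) :
    pr (fun q => a q * u q + b q * v q) p = pr b p * v p := by
  have h := (ha.hasFDerivAt.mul hu.hasFDerivAt).add (hb.hasFDerivAt.mul hv.hasFDerivAt)
  have h' : pr (fun q => a q * u q + b q * v q) p = _ :=
    congrArg (fun L : ℝ × ℝ →L[ℝ] ℝ => L (1, 0)) h.fderiv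
  rw [h']
  simp only [pr] at hur ⊢
  simp [hu0, hur, hb0, mul_comm]

theorem stmt19 (R S t x : ℝ × ℝ → ℝ) (hR : ContDiff ℝ 1 R) (hS : ContDiff ℝ 1 S)
    (ht : ContDiff ℝ 3 t) (hx : ContDiff ℝ 2 x)
    (hcomp : ∀ p, (S p - R p) * ps (pr t) p = pr R p * ps t p - ps S p * pr t p)
    (h1 : ∀ p, pr x p = -S p * pr t p)
    (h2 : ∀ p, ps x p = -R p * ps t p) :
    ∀ p, pr t p = 0 → pr (pr t) p = 0 → R p ≠ S p →
      (Xop t (Xop t t) p = pr R p * (ps t p) ^ 2 * pr (pr (pr t)) p / (R p - S p) ∧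
       Xop t (Xop t x) p = -R p * (pr R p * (ps t p) ^ 2 * pr (pr (pr t)) p / (R p - S p))) ∧
      (ps t p ≠ 0 → pr (pr (pr t)) p ≠ 0 → pr R p ≠ 0 →
        (Xop t t p = 0 ∧ Xop t x p = 0) ∧
        ¬(Xop t (Xop t t) p = 0 ∧ Xop t (Xop t x) p = 0)) := by
  intro p hr hrr hne
  have ht1 : ContDiff ℝ 2 (pr t) := ht.pr (by norm_num)
  have hdr : DifferentiableAt ℝ (pr t) p := ht1.differentiable (by norm_num) p
  have hds : DifferentiableAt ℝ (ps t) p :=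
    (ht.ps (m := 2) (by norm_num)).differentiable (by norm_num) p
  have hdrr : DifferentiableAt ℝ (pr (pr t)) p :=
    (ht1.pr (m := 1) (by norm_num)).differentiable (by norm_num) p
  have hdrs : DifferentiableAt ℝ (ps (pr t)) p :=
    (ht1.ps (m := 1) (by norm_num)).differentiable (by norm_num) p
  have hdR : DifferentiableAt ℝ R p := hR.differentiable (by norm_num) p
  have hdS : DifferentiableAt ℝ S p := hS.differentiable (by norm_num) p
  have hXt : pr (Xop t t) p = pr (pr (pr t)) p * ps t p :=
    pr_mul_add_mul_of_eq_zero hdrs.neg hdr hdrr hds hr hrr hrr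
  have hXx_eq : Xop t x =
      fun q => (ps (pr t) q * S q) * pr t q + pr (pr t) q * (-R q * ps t q) := by
    funext q
    rw [Xop, h1, h2]
    ring
  have hXx : pr (Xop t x) p = pr (pr (pr t)) p * (-R p * ps t p) := by
    rw [hXx_eq]
    exact pr_mul_add_mul_of_eq_zero (hdrs.mul hdS) hdr hdrr (hdR.neg.mul hds) hr hrr hrr
  have hX : ∀ f, Xop t f p = -ps (pr t) p * pr f p := by
    intro f
    simp [Xop, hrr]
  have hsub : R p - S p ≠ 0 := sub_ne_zero.2 hne
  have hc : ps (pr t) p = -(pr R p * ps t p) / (R p - S p) := by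
    rw [eq_div_iff hsub]
    have := hcomp p
    rw [hr] at this
    linarith
  have hXXt : Xop t (Xop t t) p =
      pr R p * (ps t p) ^ 2 * pr (pr (pr t)) p / (R p - S p) := by
    rw [hX, hXt, hc]
    ring
  refine ⟨⟨hXXt, ?_⟩, fun hs hrrr hRr => ⟨⟨?_, ?_⟩, fun h => ?_⟩⟩
  · rw [hX, hXx, hc]
    ring
  · rw [hX, hr, mul_zero]
  · rw [hX, h1, hr, mul_zero, mul_zero]
  · have hne0 : pr R p * (ps t p) ^ 2 * pr (pr (pr t)) p / (R p - S p) ≠ 0 := by positivity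
    exact hne0 (hXXt ▸ h.1)
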